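/- arXiv:1405.7546 — 2 statements merged into one kernel-verified Lean document; each statement's English description precedes it below -/
import Mathlib

section
/- Let n ≥ 2 be even and let m ≥ n+2. The polynomial f^{(2)}_{m,n} = [x₂,x₁,…,x₁][x₁,x₂][x₃,x₄]⋯[x_{n−1},x_n], where the first left-normed commutator has length m−n (one occurrence of x₂ followed by m−n−1 occurrences of x₁), is not a polynomial identity of the relatively free algebra F_n(A). -/
noncomputable section

/-- `f ∈ K⟨X⟩` (with set of variables `X`) is a polynomial identity of the `K`-algebra `R`:
every substitution of elements of `R` for the variables (i.e. every `K`-algebra homomorphism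
from the free algebra to `R`) kills `f`. -/
def IsPI (K : Type) [Field K] {X : Type} (R : Type) [Ring R] [Algebra K R]
    (f : FreeAlgebra K X) : Prop :=
  ∀ φ : FreeAlgebra K X →ₐ[K] R, φ f = 0

/-- `T(R)`: the set of polynomial identities of `R` inside `K⟨x₁, x₂, …⟩`
(the free unital associative algebra on countably many variables, indexed by `ℕ`). -/
def TId (K : Type) [Field K] (R : Type) [Ring R] [Algebra K R] : Set (FreeAlgebra K ℕ) :=
  {f | IsPI K R f}

/-- A two-sided ideal of `K⟨X⟩` is a T-ideal when it is invariant under all algebra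
endomorphisms of `K⟨X⟩`. -/
def IsTIdeal (K : Type) [Field K] (I : TwoSidedIdeal (FreeAlgebra K ℕ)) : Prop :=
  ∀ φ : FreeAlgebra K ℕ →ₐ[K] FreeAlgebra K ℕ, ∀ f ∈ I, φ f ∈ I

/-- `⟨F⟩^T`: the smallest T-ideal of `K⟨X⟩` containing the set `F`. -/
def TIdealGen (K : Type) [Field K] (F : Set (FreeAlgebra K ℕ)) : Set (FreeAlgebra K ℕ) :=
  {g | ∀ I : TwoSidedIdeal (FreeAlgebra K ℕ), IsTIdeal K I → F ⊆ (I : Set (FreeAlgebra K ℕ)) → g ∈ I}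

/-- The commutator `[a, b] = a * b - b * a`. -/
def br {R : Type} [Ring R] (a b : R) : R := a * b - b * a

/-- The left-normed commutator `[a, b, b, …, b]` with `k` occurrences of `b`. -/
def commPow {R : Type} [Ring R] (a b : R) (k : ℕ) : R := (fun y => br y b)^[k] a

/-- The variable `xᵢ` of `K⟨x₁, x₂, …⟩` (1-based indexing). -/
def xv (K : Type) [Field K] (i : ℕ) : FreeAlgebra K ℕ := FreeAlgebra.ι K i

/-- The product of commutators `[x₁,x₂][x₃,x₄]⋯[x_{2k-1},x_{2k}]`. -/
def chainProd (K : Type) [Field K] (k : ℕ) : FreeAlgebra K ℕ :=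
  ((List.range k).map fun i => br (xv K (2 * i + 1)) (xv K (2 * i + 2))).prod

/-- The Grassmann (exterior) algebra of an infinite dimensional `K`-vector space
with basis `e₁, e₂, …`. -/
abbrev Einf (K : Type) [Field K] : Type := ExteriorAlgebra K (ℕ →₀ K)

/-- The Grassmann (exterior) algebra `E⁽ⁿ⁾` of an `n`-dimensional `K`-vector space. -/
abbrev Efin (K : Type) [Field K] (n : ℕ) : Type := ExteriorAlgebra K (Fin n → K)

/-- The even part `E₀` of the Grassmann algebra of `V`. -/
def evenPart (K V : Type) [Field K] [AddCommGroup V] [Module K V] :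
    Submodule K (ExteriorAlgebra K V) :=
  CliffordAlgebra.evenOdd (0 : QuadraticForm K V) 0

/-- The odd part `E₁` of the Grassmann algebra of `V`. -/
def oddPart (K V : Type) [Field K] [AddCommGroup V] [Module K V] :
    Submodule K (ExteriorAlgebra K V) :=
  CliffordAlgebra.evenOdd (0 : QuadraticForm K V) 1

section matrixAlgebras

variable (K V : Type) [Field K] [AddCommGroup V] [Module K V]

private theorem evenPart_mul_mem {a b : ExteriorAlgebra K V}
    (ha : a ∈ evenPart K V) (hb : b ∈ evenPart K V) : a * b ∈ evenPart K V := by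
  have := CliffordAlgebra.evenOdd_mul_le (Q := (0 : QuadraticForm K V)) 0 0
    (Submodule.mul_mem_mul ha hb)
  simpa [evenPart] using this

private theorem evenPart_one_mem : (1 : ExteriorAlgebra K V) ∈ evenPart K V :=
  SetLike.one_mem_graded _

private theorem evenPart_algebraMap_mem (c : K) :
    algebraMap K (ExteriorAlgebra K V) c ∈ evenPart K V :=
  SetLike.algebraMap_mem_graded _ c

/-- The algebra `A` (over the Grassmann algebra of `V`): the subalgebra of `2 × 2`
matrices over `E = Λ(V)` whose `(1,1)` entry lies in `E₀`, whose `(2,1)` entry is `0`,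
and whose `(1,2)` and `(2,2)` entries are arbitrary. -/
def algA : Subalgebra K (Matrix (Fin 2) (Fin 2) (ExteriorAlgebra K V)) where
  carrier := {M | M 0 0 ∈ evenPart K V ∧ M 1 0 = 0}
  mul_mem' := by
    rintro a b ⟨ha0, ha1⟩ ⟨hb0, hb1⟩
    refine ⟨?_, ?_⟩
    · have h : (a * b) 0 0 = a 0 0 * b 0 0 + a 0 1 * b 1 0 := by
        simp [Matrix.mul_apply, Fin.sum_univ_two]
      rw [h, hb1, mul_zero, add_zero]
      exact evenPart_mul_mem K V ha0 hb0
    · have h : (a * b) 1 0 = a 1 0 * b 0 0 + a 1 1 * b 1 0 := by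
        simp [Matrix.mul_apply, Fin.sum_univ_two]
      rw [h, ha1, hb1, zero_mul, mul_zero, add_zero]
  one_mem' := by
    refine ⟨?_, ?_⟩
    · rw [Matrix.one_apply_eq]; exact evenPart_one_mem K V
    · exact Matrix.one_apply_ne (by decide)
  add_mem' := by
    rintro a b ⟨ha0, ha1⟩ ⟨hb0, hb1⟩
    exact ⟨Submodule.add_mem _ ha0 hb0, by simp [ha1, hb1]⟩
  zero_mem' := ⟨Submodule.zero_mem _, rfl⟩
  algebraMap_mem' := fun c => by
    refine ⟨?_, ?_⟩
    · rw [Matrix.algebraMap_matrix_apply, if_pos rfl]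
      exact evenPart_algebraMap_mem K V c
    · rw [Matrix.algebraMap_matrix_apply, if_neg (by decide)]

end matrixAlgebras

section matrixAlgebras2

variable (K V : Type) [Field K] [AddCommGroup V] [Module K V]

private theorem oddPart_mul_mem_even {a b : ExteriorAlgebra K V}
    (ha : a ∈ oddPart K V) (hb : b ∈ oddPart K V) : a * b ∈ evenPart K V := by
  have := CliffordAlgebra.evenOdd_mul_le (Q := (0 : QuadraticForm K V)) 1 1
    (Submodule.mul_mem_mul ha hb)
  have h2 : ((1 : ZMod 2) + 1) = 0 := by decide
  rw [h2] at this
  exact this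

private theorem even_mul_odd_mem {a b : ExteriorAlgebra K V}
    (ha : a ∈ evenPart K V) (hb : b ∈ oddPart K V) : a * b ∈ oddPart K V := by
  have := CliffordAlgebra.evenOdd_mul_le (Q := (0 : QuadraticForm K V)) 0 1
    (Submodule.mul_mem_mul ha hb)
  rw [zero_add] at this
  exact this

private theorem odd_mul_even_mem {a b : ExteriorAlgebra K V}
    (ha : a ∈ oddPart K V) (hb : b ∈ evenPart K V) : a * b ∈ oddPart K V := by
  have := CliffordAlgebra.evenOdd_mul_le (Q := (0 : QuadraticForm K V)) 1 0
    (Submodule.mul_mem_mul ha hb)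
  rw [add_zero] at this
  exact this

/-- The algebra `A′` (over the Grassmann algebra of `V`): the subalgebra of `2 × 2`
matrices over `E = Λ(V)` whose `(2,2)` entry lies in `E₀`, whose `(2,1)` entry is `0`,
and whose `(1,1)` and `(1,2)` entries are arbitrary. -/
def algA' : Subalgebra K (Matrix (Fin 2) (Fin 2) (ExteriorAlgebra K V)) where
  carrier := {M | M 1 1 ∈ evenPart K V ∧ M 1 0 = 0}
  mul_mem' := by
    rintro a b ⟨ha0, ha1⟩ ⟨hb0, hb1⟩
    refine ⟨?_, ?_⟩
    · have h : (a * b) 1 1 = a 1 0 * b 0 1 + a 1 1 * b 1 1 := by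
        simp [Matrix.mul_apply, Fin.sum_univ_two]
      rw [h, ha1, zero_mul, zero_add]
      exact evenPart_mul_mem K V ha0 hb0
    · have h : (a * b) 1 0 = a 1 0 * b 0 0 + a 1 1 * b 1 0 := by
        simp [Matrix.mul_apply, Fin.sum_univ_two]
      rw [h, ha1, hb1, zero_mul, mul_zero, add_zero]
  one_mem' := by
    refine ⟨?_, ?_⟩
    · rw [Matrix.one_apply_eq]; exact evenPart_one_mem K V
    · exact Matrix.one_apply_ne (by decide)
  add_mem' := by
    rintro a b ⟨ha0, ha1⟩ ⟨hb0, hb1⟩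
    exact ⟨Submodule.add_mem _ ha0 hb0, by simp [ha1, hb1]⟩
  zero_mem' := ⟨Submodule.zero_mem _, rfl⟩
  algebraMap_mem' := fun c => by
    refine ⟨?_, ?_⟩
    · rw [Matrix.algebraMap_matrix_apply, if_pos rfl]
      exact evenPart_algebraMap_mem K V c
    · rw [Matrix.algebraMap_matrix_apply, if_neg (by decide)]

/-- The algebra `M_{1,1}` (over the Grassmann algebra of `V`): the subalgebra of `2 × 2`
matrices over `E = Λ(V)` whose diagonal entries lie in `E₀` and whose off-diagonal entries
lie in `E₁`. -/
def m11 : Subalgebra K (Matrix (Fin 2) (Fin 2) (ExteriorAlgebra K V)) where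
  carrier := {M | M 0 0 ∈ evenPart K V ∧ M 1 1 ∈ evenPart K V ∧
    M 0 1 ∈ oddPart K V ∧ M 1 0 ∈ oddPart K V}
  mul_mem' := by
    rintro a b ⟨ha00, ha11, ha01, ha10⟩ ⟨hb00, hb11, hb01, hb10⟩
    have h00 : (a * b) 0 0 = a 0 0 * b 0 0 + a 0 1 * b 1 0 := by
      simp [Matrix.mul_apply, Fin.sum_univ_two]
    have h11 : (a * b) 1 1 = a 1 0 * b 0 1 + a 1 1 * b 1 1 := by
      simp [Matrix.mul_apply, Fin.sum_univ_two]
    have h01 : (a * b) 0 1 = a 0 0 * b 0 1 + a 0 1 * b 1 1 := by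
      simp [Matrix.mul_apply, Fin.sum_univ_two]
    have h10 : (a * b) 1 0 = a 1 0 * b 0 0 + a 1 1 * b 1 0 := by
      simp [Matrix.mul_apply, Fin.sum_univ_two]
    refine ⟨?_, ?_, ?_, ?_⟩
    · rw [h00]
      exact Submodule.add_mem _ (evenPart_mul_mem K V ha00 hb00)
        (oddPart_mul_mem_even K V ha01 hb10)
    · rw [h11]
      exact Submodule.add_mem _ (oddPart_mul_mem_even K V ha10 hb01)
        (evenPart_mul_mem K V ha11 hb11)
    · rw [h01]
      exact Submodule.add_mem _ (even_mul_odd_mem K V ha00 hb01)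
        (odd_mul_even_mem K V ha01 hb11)
    · rw [h10]
      exact Submodule.add_mem _ (odd_mul_even_mem K V ha10 hb00)
        (even_mul_odd_mem K V ha11 hb10)
  one_mem' := by
    refine ⟨?_, ?_, ?_, ?_⟩
    · rw [Matrix.one_apply_eq]; exact evenPart_one_mem K V
    · rw [Matrix.one_apply_eq]; exact evenPart_one_mem K V
    · rw [Matrix.one_apply_ne (by decide)]; exact Submodule.zero_mem _
    · rw [Matrix.one_apply_ne (by decide)]; exact Submodule.zero_mem _
  add_mem' := by
    rintro a b ⟨ha00, ha11, ha01, ha10⟩ ⟨hb00, hb11, hb01, hb10⟩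
    exact ⟨Submodule.add_mem _ ha00 hb00, Submodule.add_mem _ ha11 hb11,
      Submodule.add_mem _ ha01 hb01, Submodule.add_mem _ ha10 hb10⟩
  zero_mem' := ⟨Submodule.zero_mem _, Submodule.zero_mem _,
    Submodule.zero_mem _, Submodule.zero_mem _⟩
  algebraMap_mem' := fun c => by
    refine ⟨?_, ?_, ?_, ?_⟩
    · rw [Matrix.algebraMap_matrix_apply, if_pos rfl]
      exact evenPart_algebraMap_mem K V c
    · rw [Matrix.algebraMap_matrix_apply, if_pos rfl]
      exact evenPart_algebraMap_mem K V c
    · rw [Matrix.algebraMap_matrix_apply, if_neg (by decide)]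
      exact Submodule.zero_mem _
    · rw [Matrix.algebraMap_matrix_apply, if_neg (by decide)]
      exact Submodule.zero_mem _

end matrixAlgebras2

/-- The relatively free algebra `F_n(R) = K⟨x₁, …, xₙ⟩ / (K⟨x₁, …, xₙ⟩ ∩ T(R))` of rank `n`
of the variety generated by `R`: the quotient of the free algebra on `n` variables by the
ideal of polynomial identities of `R` in those variables. -/
abbrev RelFree (K : Type) [Field K] (R : Type) [Ring R] [Algebra K R] (n : ℕ) : Type :=
  RingQuot (fun f g : FreeAlgebra K (Fin n) => IsPI K R (f - g))

end

theorem map_br {R S F : Type} [Ring R] [Ring S] [FunLike F R S] [RingHomClass F R S]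
    (φ : F) (a b : R) : φ (br a b) = br (φ a) (φ b) := by
  simp [br]

theorem commPow_succ {R : Type} [Ring R] (a b : R) (k : ℕ) :
    commPow a b (k + 1) = br (commPow a b k) b :=
  Function.iterate_succ_apply' _ _ _

theorem map_commPow {R S F : Type} [Ring R] [Ring S] [FunLike F R S] [RingHomClass F R S]
    (φ : F) (a b : R) (k : ℕ) : φ (commPow a b k) = commPow (φ a) (φ b) k := by
  induction k with
  | zero => rfl
  | succ k ih => rw [commPow_succ, commPow_succ, map_br, ih]

theorem commPow_upperTriangular {R : Type} [Ring R] (u v : R) (k : ℕ) :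
    commPow !![0, 1; 0, v] !![0, 0; 0, u] k 0 0 = 0 ∧
      commPow !![0, 1; 0, v] !![0, 0; 0, u] k 0 1 = u ^ k := by
  induction k with
  | zero => simp [commPow]
  | succ k ih =>
    rw [commPow_succ]
    simp [br, Matrix.mul_apply, Matrix.vecMul, dotProduct, Fin.sum_univ_two, ih.2, pow_succ]

noncomputable section Grassmann

variable (K : Type) [Field K]

/-- The generator `eᵢ` of the Grassmann algebra. -/
def grassmannGen (i : ℕ) : Einf K := ExteriorAlgebra.ι K (Finsupp.single i 1)

/-- The product `e₁e₂⋯eₙ` in the Grassmann algebra. -/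
def grassmannProd (n : ℕ) : Einf K := ((List.range n).map fun i => grassmannGen K (i + 1)).prod

theorem grassmannGen_mul_self (i : ℕ) : grassmannGen K i * grassmannGen K i = 0 :=
  ExteriorAlgebra.ι_sq_zero _

theorem br_grassmannGen (i j : ℕ) :
    br (grassmannGen K i) (grassmannGen K j) = 2 * (grassmannGen K i * grassmannGen K j) := by
  have h : grassmannGen K i * grassmannGen K j + grassmannGen K j * grassmannGen K i = 0 :=
    ExteriorAlgebra.ι_add_mul_swap _ _
  rw [br, eq_neg_of_add_eq_zero_right h, sub_neg_eq_add, two_mul]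

theorem grassmannProd_succ (n : ℕ) :
    grassmannProd K (n + 1) = grassmannProd K n * grassmannGen K (n + 1) := by
  simp [grassmannProd, List.range_succ]

theorem grassmannGen_one_mul_grassmannProd {n : ℕ} (hn : n ≠ 0) :
    grassmannGen K 1 * grassmannProd K n = 0 := by
  obtain ⟨n, rfl⟩ := Nat.exists_eq_succ_of_ne_zero hn
  rw [grassmannProd, List.range_succ_eq_map, List.map_cons, List.prod_cons, ← mul_assoc,
    grassmannGen_mul_self, zero_mul]

theorem grassmannProd_ne_zero (n : ℕ) : grassmannProd K n ≠ 0 := by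
  let r : (ℕ →₀ K) →ₗ[K] (Fin n → K) := LinearMap.pi fun i => Finsupp.lapply ((i : ℕ) + 1)
  let d : ∀ i, (ℕ →₀ K) [⋀^Fin i]→ₗ[K] K :=
    Pi.single n ((Matrix.detRowAlternating (n := Fin n) (R := K)).compLinearMap r)
  have hprod : grassmannProd K n =
      ExteriorAlgebra.ιMulti K n fun i : Fin n => Finsupp.single ((i : ℕ) + 1) (1 : K) := by
    rw [ExteriorAlgebra.ιMulti_apply, grassmannProd, ← List.map_coe_finRange_eq_range, List.map_map,
      List.ofFn_eq_map]
    rfl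
  intro h
  have hd := congrArg (ExteriorAlgebra.liftAlternating d) h
  rw [hprod, ExteriorAlgebra.liftAlternating_apply_ιMulti, map_zero] at hd
  have hone : (fun i : Fin n => r (Finsupp.single ((i : ℕ) + 1) (1 : K))) =
      (1 : Matrix (Fin n) (Fin n) K) := by
    ext i j
    simp [r, Finsupp.single_apply, Matrix.one_apply, Fin.ext_iff]
  have hdet : d n (fun i : Fin n => Finsupp.single ((i : ℕ) + 1) (1 : K)) = 1 := by
    simp only [d, Pi.single_eq_same, AlternatingMap.compLinearMap_apply]
    exact (congrArg Matrix.det hone).trans Matrix.det_one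
  exact one_ne_zero (hdet.symm.trans hd)

/-- Upper triangular matrices in `A` witnessing that `f⁽²⁾` does not vanish. -/
def witness (i : ℕ) : algA K (ℕ →₀ K) :=
  ⟨!![0, if i = 2 then 1 else 0; 0, (if i = 1 then 1 else 0) + grassmannGen K i],
    Submodule.zero_mem _, rfl⟩

end Grassmann

section UpperTriangular

variable {K V : Type} [Field K] [AddCommGroup V] [Module K V]

theorem algA_mul_one_one (M N : algA K V) : (M * N).1 1 1 = M.1 1 1 * N.1 1 1 := by
  have hM : M.1 1 0 = 0 := M.2.2
  simp [Matrix.mul_apply, Fin.sum_univ_two, hM]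

theorem algA_br_one_one (M N : algA K V) : (br M N).1 1 1 = br (M.1 1 1) (N.1 1 1) := by
  rw [br, br, ← algA_mul_one_one, ← algA_mul_one_one]
  rfl

end UpperTriangular

section Evaluation

variable {K : Type} [Field K]

theorem chainProd_witness (ψ : FreeAlgebra K ℕ →ₐ[K] algA K (ℕ →₀ K)) (k : ℕ)
    (hψ : ∀ i, 1 ≤ i → i ≤ 2 * k → ψ (xv K i) = witness K i) :
    (ψ (chainProd K k)).1 1 1 = 2 ^ k * grassmannProd K (2 * k) := by
  induction k with
  | zero => simp [chainProd, grassmannProd]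
  | succ k ih =>
    have hbr : (ψ (br (xv K (2 * k + 1)) (xv K (2 * k + 2)))).1 1 1 =
        2 * (grassmannGen K (2 * k + 1) * grassmannGen K (2 * k + 2)) := by
      rw [map_br, hψ _ (by omega) (by omega), hψ _ (by omega) (by omega), algA_br_one_one,
        ← br_grassmannGen]
      by_cases hk : k = 0
      · simp [witness, br, hk]
        noncomm_ring
      · simp [witness, br, hk]
    have hchain : chainProd K (k + 1) =
        chainProd K k * br (xv K (2 * k + 1)) (xv K (2 * k + 2)) := by
      simp [chainProd, List.range_succ]
    rw [hchain, map_mul, algA_mul_one_one, hbr, ih fun i h₁ h₂ => hψ i h₁ (by omega),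
      show 2 * (k + 1) = 2 * k + 1 + 1 by ring, grassmannProd_succ, grassmannProd_succ, pow_succ]
    have h2 : grassmannProd K (2 * k) * 2 = 2 * grassmannProd K (2 * k) :=
      (Nat.cast_commute 2 _).symm.eq
    simp only [← mul_assoc]
    rw [mul_assoc (2 ^ k) (grassmannProd K (2 * k)) 2, h2, ← mul_assoc]

theorem eval_witness_ne_zero [CharZero K] (ψ : FreeAlgebra K ℕ →ₐ[K] algA K (ℕ →₀ K))
    {k : ℕ} (hk : k ≠ 0) (j : ℕ)
    (hψ : ∀ i, 1 ≤ i → i ≤ 2 * k → ψ (xv K i) = witness K i) :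
    ψ (commPow (xv K 2) (xv K 1) j * chainProd K k) ≠ 0 := by
  intro h
  have hcomm : (ψ (commPow (xv K 2) (xv K 1) j)).1 =
      commPow !![0, 1; 0, grassmannGen K 2] !![0, 0; 0, 1 + grassmannGen K 1] j := by
    rw [map_commPow, hψ 1 le_rfl (by omega), hψ 2 (by omega) (by omega)]
    refine (map_commPow (algA K (ℕ →₀ K)).val _ _ j).trans ?_
    simp [witness]
  have hentry := congrArg (fun M : algA K (ℕ →₀ K) => M.1 0 1) h
  simp only [map_mul, Subalgebra.coe_mul, Matrix.mul_apply, Fin.sum_univ_two] at hentry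
  rw [hcomm, (commPow_upperTriangular _ _ j).1, (commPow_upperTriangular _ _ j).2,
    chainProd_witness ψ k hψ] at hentry
  have hfix : ∀ l : ℕ, (1 + grassmannGen K 1) ^ l * grassmannProd K (2 * k) =
      grassmannProd K (2 * k) := by
    intro l
    induction l with
    | zero => simp
    | succ l ih =>
      rw [pow_succ, mul_assoc, add_mul, one_mul,
        grassmannGen_one_mul_grassmannProd K (by omega), add_zero, ih]
  have h2 : (1 + grassmannGen K 1) ^ j * 2 ^ k = 2 ^ k * (1 + grassmannGen K 1) ^ j :=
    ((Nat.cast_commute 2 _).pow_left k).symm.eq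
  rw [zero_mul, zero_add, ← mul_assoc, h2, mul_assoc, hfix] at hentry
  have hsmul : (2 ^ k : K) • grassmannProd K (2 * k) = 0 := by
    rw [Algebra.smul_def, map_pow, map_ofNat]
    exact hentry
  rcases smul_eq_zero.mp hsmul with h0 | h0
  · exact pow_ne_zero k two_ne_zero h0
  · exact grassmannProd_ne_zero K _ h0

end Evaluation

/-- For even `n ≥ 2` and `m ≥ n + 2`, the polynomial
`f⁽²⁾_{m,n} = [x₂,x₁,…,x₁][x₁,x₂][x₃,x₄]⋯[x_{n-1},xₙ]` (first commutator of length `m - n`)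
is not a polynomial identity of `F_n(A)`. -/
theorem f2_not_identity_of_relfree (K : Type) [Field K] [CharZero K]
    (n m : ℕ) (hn : 2 ≤ n) (hne : Even n) (hm : n + 2 ≤ m) :
    ¬ IsPI K (RelFree K (↥(algA K (ℕ →₀ K))) n)
        (commPow (xv K 2) (xv K 1) (m - n - 1) * chainProd K (n / 2)) := by
  obtain ⟨k, rfl⟩ := hne.two_dvd
  intro h
  let A := algA K (ℕ →₀ K)
  let π : FreeAlgebra K (Fin (2 * k)) →ₐ[K] A :=
    FreeAlgebra.lift K fun i => witness K ((i : ℕ) + 1)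
  let ρ : RelFree K A (2 * k) →ₐ[K] A := RingQuot.liftAlgHom K ⟨π, fun f g hfg =>
    sub_eq_zero.mp ((map_sub π f g).symm.trans (hfg π))⟩
  let φ : FreeAlgebra K ℕ →ₐ[K] RelFree K A (2 * k) := FreeAlgebra.lift K fun i =>
    if hi : i - 1 < 2 * k then RingQuot.mkAlgHom K _ (FreeAlgebra.ι K ⟨i - 1, hi⟩) else 0
  rw [Nat.mul_div_cancel_left k two_pos] at h
  refine eval_witness_ne_zero (ρ.comp φ) (k := k) (by omega) (m - 2 * k - 1) ?_ ?_
  · intro i h₁ h₂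
    have hi : i - 1 < 2 * k := by omega
    simp [φ, ρ, π, xv, hi, Nat.sub_add_cancel h₁]
  · rw [AlgHom.comp_apply, h φ, map_zero]
end

section
/- Let n ≥ 2 be even and let m ≥ n+2. The polynomial f^{(3)}_{m,n+1} = Σ_{σ ∈ S_{n+1}} sgn(σ) [x_{σ(1)},x₁,…,x₁][x_{σ(2)},x_{σ(3)}]⋯[x_{σ(n)},x_{σ(n+1)}], where the first left-normed commutator has m−n−1 occurrences of x₁ after x_{σ(1)} and the sum runs over all permutations σ of {1,…,n+1}, is not a polynomial identity of the relatively free algebra F_n(A). -/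
section Helpers

/-- The matrix `b e₁₂ + d e₂₂`. -/
def secondCol {R : Type} [Ring R] (b d : R) : Matrix (Fin 2) (Fin 2) R := !![0, b; 0, d]

theorem secondCol_mul {R : Type} [Ring R] (b d b' d' : R) :
    secondCol b d * secondCol b' d' = secondCol (b * d') (d * d') := by
  simp [secondCol]

theorem br_secondCol {R : Type} [Ring R] (b d b' d' : R) :
    br (secondCol b d) (secondCol b' d') = secondCol (b * d' - b' * d) (br d d') := by
  rw [br, secondCol_mul, secondCol_mul]
  simp [secondCol, br]

theorem commPow_secondCol {R : Type} [Ring R] (b d c : R) (k : ℕ) :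
    commPow (secondCol b d) (secondCol 0 c) k = secondCol (b * c ^ k) (commPow d c k) := by
  induction k with
  | zero => simp [commPow]
  | succ k ih =>
    simp only [commPow, Function.iterate_succ_apply'] at ih ⊢
    rw [ih, br_secondCol]
    simp [pow_succ, mul_assoc]

theorem secondCol_mul_prod_apply {R : Type} [Ring R] {k : ℕ} (b d : R) (f g : Fin k → R) :
    (secondCol b d * (List.ofFn fun i => secondCol (f i) (g i)).prod) 0 1 =
      b * (List.ofFn g).prod := by
  induction k generalizing b d with
  | zero => simp [secondCol]
  | succ k ih =>
    simp only [List.ofFn_succ, List.prod_cons]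
    rw [← mul_assoc, secondCol_mul, ih, mul_assoc]

theorem prod_ofFn_smul {K R : Type} [Field K] [Ring R] [Algebra K R] {k : ℕ} (c : K)
    (f : Fin k → R) : (List.ofFn fun i => c • f i).prod = c ^ k • (List.ofFn f).prod := by
  induction k with
  | zero => simp
  | succ k ih => simp [List.ofFn_succ, ih, pow_succ, mul_smul]

theorem prod_ofFn_pairs {R : Type} [Ring R] {n k : ℕ} (h : n = k * 2) (w : Fin (n + 1) → R) :
    (List.ofFn fun i : Fin k =>
      w ⟨2 * i.1 + 1, by have := i.2; omega⟩ * w ⟨2 * i.1 + 2, by have := i.2; omega⟩).prod =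
      (List.ofFn fun i : Fin n => w i.succ).prod := by
  subst h
  rw [List.ofFn_mul, List.prod_flatten, List.map_ofFn]
  congr 2
  funext i
  simp [List.ofFn_succ, Fin.succ, mul_comm]

/-- Vanishing of an identity of `F_n(R)` under substitutions of elements of an
`n`-generated subalgebra of `R`. -/
theorem IsPI.lift_eq_zero_of_relFree {K R : Type} [Field K] [Ring R] [Algebra K R] {n : ℕ}
    {f : FreeAlgebra K ℕ} (hf : IsPI K (RelFree K R n) f) (g : Fin n → R)
    (p : ℕ → FreeAlgebra K (Fin n)) :
    FreeAlgebra.lift K (fun j => FreeAlgebra.lift K g (p j)) f = 0 := by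
  let θ : RelFree K R n →ₐ[K] R := RingQuot.liftAlgHom K ⟨FreeAlgebra.lift K g, by
    intro a b hab
    have := hab (FreeAlgebra.lift K g)
    rwa [map_sub, sub_eq_zero] at this⟩
  have h1 := congrArg θ (hf ((RingQuot.mkAlgHom K _).comp (FreeAlgebra.lift K p)))
  have h2 : FreeAlgebra.lift K (fun j => FreeAlgebra.lift K g (p j)) =
      θ.comp ((RingQuot.mkAlgHom K _).comp (FreeAlgebra.lift K p)) := by
    ext j
    simp [θ]
  rw [h2]
  simpa using h1

section Exterior

variable {K V : Type} [Field K] [AddCommGroup V] [Module K V]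

open ExteriorAlgebra in
theorem br_ι_add_central (x y : V) (z t : ExteriorAlgebra K V)
    (hz : ∀ a, Commute z a) (ht : ∀ a, Commute t a) :
    br (ι K x + z) (ι K y + t) = (2 : K) • (ι K x * ι K y) := by
  have h : ι K y * ι K x = -(ι K x * ι K y) :=
    eq_neg_of_add_eq_zero_right (ι_add_mul_swap x y)
  have h1 := (hz (ι K y)).eq
  have h2 := (hz t).eq
  have h3 := (ht (ι K x)).eq
  simp only [br, mul_add, add_mul, h, h1, h2, h3, two_smul]
  abel

open ExteriorAlgebra in
theorem commute_ι_mul_ι (x y : V) (a : ExteriorAlgebra K V) : Commute (ι K x * ι K y) a := by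
  have h (u v : V) : ι K u * ι K v = -(ι K v * ι K u) :=
    eq_neg_of_add_eq_zero_left (ι_add_mul_swap u v)
  induction a using ExteriorAlgebra.induction with
  | algebraMap r => exact (Algebra.commutes r _).symm
  | ι v =>
    rw [Commute, SemiconjBy, mul_assoc, h y v, mul_neg, ← mul_assoc, h x v, neg_mul, neg_neg,
      mul_assoc]
  | mul a b ha hb => exact ha.mul_right hb
  | add a b ha hb => exact ha.add_right hb

open ExteriorAlgebra in
theorem one_add_ι_pow_mul_ιMulti {n : ℕ} (w : Fin n → V) (i : Fin n) (k : ℕ) :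
    (1 + ι K (w i)) ^ k * ιMulti K n w = ιMulti K n w := by
  have h : ι K (w i) * ιMulti K n w = 0 := by
    have h0 : ιMulti K (n + 1) (Fin.cons (w i) w : Fin (n + 1) → V) = 0 :=
      AlternatingMap.map_eq_zero_of_eq _ _ (i := 0) (j := i.succ) (by simp)
        (Fin.succ_ne_zero i).symm
    rw [ιMulti_apply, List.ofFn_succ, List.prod_cons] at h0
    rw [ιMulti_apply]
    simpa using h0
  induction k with
  | zero => simp
  | succ k ih => rw [pow_succ, mul_assoc, add_mul, h, one_mul, add_zero, ih]

open ExteriorAlgebra in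
theorem ιMulti_single_ne_zero (n : ℕ) :
    ιMulti K n (fun i : Fin n => (Finsupp.single (i : ℕ) (1 : K) : ℕ →₀ K)) ≠ 0 := by
  classical
  intro h
  let D : (ℕ →₀ K) [⋀^Fin n]→ₗ[K] K :=
    (Matrix.detRowAlternating (R := K) (n := Fin n)).compLinearMap
      (LinearMap.pi fun i : Fin n => Finsupp.lapply (i : ℕ))
  have h1 := congrArg (liftAlternating (R := K) (M := ℕ →₀ K) (N := K)
    (fun k => if hk : n = k then hk ▸ D else 0)) h
  rw [liftAlternating_apply_ιMulti, map_zero] at h1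
  have h2 : (fun i : Fin n => LinearMap.pi (fun i : Fin n => Finsupp.lapply (R := K) (i : ℕ))
      (Finsupp.single (i : ℕ) (1 : K))) = (1 : Matrix (Fin n) (Fin n) K) := by
    ext i j
    simp [Matrix.one_apply, Finsupp.single_apply, Fin.ext_iff]
  have h3 : Matrix.det (1 : Matrix (Fin n) (Fin n) K) = 0 := by
    rw [← h2]
    simpa [D] using! h1
  simp at h3

open ExteriorAlgebra in
theorem sum_perm_sign_smul_ιMulti {n : ℕ} (v : Fin (n + 1) → V) (j : Fin (n + 1)) :
    ∑ σ : Equiv.Perm (Fin (n + 1)), (Equiv.Perm.sign σ : ℤ) •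
        (if σ 0 = j then ιMulti K n (fun i => v (σ i.succ)) else 0) =
      (Equiv.Perm.sign (Equiv.swap 0 j) : ℤ) • n.factorial •
        ιMulti K n (fun i => v (Equiv.swap 0 j i.succ)) := by
  classical
  rw [← Equiv.Perm.decomposeFin.symm.sum_comp, Fintype.sum_prod_type, Finset.sum_eq_single j]
  · have h (e : Equiv.Perm (Fin n)) :
        ιMulti K n (fun i => v (Equiv.swap 0 j (e i).succ)) =
          (Equiv.Perm.sign e : ℤ) • ιMulti K n (fun i => v (Equiv.swap 0 j i.succ)) :=
      AlternatingMap.map_perm (ιMulti K n) (fun i => v (Equiv.swap 0 j i.succ)) e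
    have h' (e : Equiv.Perm (Fin n)) : (Equiv.Perm.sign e : ℤ) * (Equiv.Perm.sign e : ℤ) = 1 := by
      rw [← Units.val_mul, Int.units_mul_self, Units.val_one]
    have hs (e : Equiv.Perm (Fin n)) :
        (Equiv.Perm.sign (Equiv.Perm.decomposeFin.symm (j, e)) : ℤ) =
          Equiv.Perm.sign (Equiv.swap 0 j) * Equiv.Perm.sign e := by
      rw [Equiv.Perm.decomposeFin.symm_sign, Equiv.Perm.sign_swap']
      by_cases hj : j = 0 <;> simp [hj, eq_comm]
    simp only [Equiv.Perm.decomposeFin_symm_apply_zero, Equiv.Perm.decomposeFin_symm_apply_succ,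
      if_true, hs, h, smul_smul, mul_assoc, h', mul_one, Finset.sum_const, Finset.card_univ,
      Fintype.card_perm, Fintype.card_fin]
    exact smul_comm _ _ _
  · intro b _ hb
    simp [hb]
  · simp

open ExteriorAlgebra in
/-- The `(1,2)` entry of one summand of `f⁽³⁾` at the matrices
`β j e₁₂ + (ι (v j) + z j) e₂₂` with `z j` central. -/
theorem secondCol_commPow_mul_prod_br_apply {n k : ℕ} (hpar : n = n / 2 * 2) (hn1 : 1 < n)
    (v : Fin (n + 1) → V) (z β : Fin (n + 1) → ExteriorAlgebra K V)
    (hz : ∀ j a, Commute (z j) a) (hz0 : z 0 = 1) (hβ1 : β ⟨1, by omega⟩ = 1)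
    (hβ : ∀ j, j ≠ ⟨1, by omega⟩ → β j = 0) (σ : Equiv.Perm (Fin (n + 1))) :
    (commPow (secondCol (β (σ 0)) (ι K (v (σ 0)) + z (σ 0))) (secondCol 0 (ι K (v 0) + z 0)) k *
      (List.ofFn fun i : Fin (n / 2) =>
        br (secondCol (β (σ ⟨2 * i.1 + 1, by have := i.2; omega⟩))
              (ι K (v (σ ⟨2 * i.1 + 1, by have := i.2; omega⟩)) +
                z (σ ⟨2 * i.1 + 1, by have := i.2; omega⟩)))
           (secondCol (β (σ ⟨2 * i.1 + 2, by have := i.2; omega⟩))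
              (ι K (v (σ ⟨2 * i.1 + 2, by have := i.2; omega⟩)) +
                z (σ ⟨2 * i.1 + 2, by have := i.2; omega⟩)))).prod) 0 1 =
      (2 : K) ^ (n / 2) •
        (if σ 0 = ⟨1, by omega⟩ then ιMulti K n (fun i => v (σ i.succ)) else 0) := by
  simp only [commPow_secondCol, br_secondCol]
  rw [secondCol_mul_prod_apply]
  simp only [br_ι_add_central _ _ _ _ (hz _) (hz _)]
  rw [prod_ofFn_smul, prod_ofFn_pairs hpar (fun j => ι K (v (σ j))), mul_smul_comm,
    ← ιMulti_apply (v := fun i => v (σ i.succ))]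
  congr 1
  split_ifs with hσ
  · obtain ⟨i, hi⟩ : ∃ i : Fin n, σ i.succ = 0 := by
      have : σ.symm 0 ≠ 0 := by
        intro h
        rw [Equiv.symm_apply_eq, hσ] at h
        simp [Fin.ext_iff] at h
      obtain ⟨i, hi⟩ := Fin.exists_succ_eq.mpr this
      exact ⟨i, by rw [hi, Equiv.apply_symm_apply]⟩
    have := one_add_ι_pow_mul_ιMulti (K := K) (fun i => v (σ i.succ)) i k
    rw [hi] at this
    rw [hσ, hβ1, one_mul, hz0, add_comm, this]
  · rw [hβ _ hσ, zero_mul, zero_mul]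

end Exterior

end Helpers

/-- For even `n ≥ 2` and `m ≥ n + 2`, the polynomial
`f⁽³⁾_{m,n+1} = Σ_{σ ∈ S_{n+1}} sgn(σ)·[x_{σ(1)},x₁,…,x₁][x_{σ(2)},x_{σ(3)}]⋯[x_{σ(n)},x_{σ(n+1)}]`
(with `m - n - 1` occurrences of `x₁` after `x_{σ(1)}`) is not a polynomial identity of
`F_n(A)`. -/
theorem f3_not_identity_of_relfree (K : Type) [Field K] [CharZero K]
    (n m : ℕ) (hn : 2 ≤ n) (hne : Even n) (hm : n + 2 ≤ m) :
    ¬ IsPI K (RelFree K (↥(algA K (ℕ →₀ K))) n)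
        (∑ σ : Equiv.Perm (Fin (n + 1)), (Equiv.Perm.sign σ : ℤ) •
          (commPow (xv K ((σ 0 : ℕ) + 1)) (xv K 1) (m - n - 1) *
            (List.ofFn fun i : Fin (n / 2) =>
              br (xv K ((σ ⟨2 * i.1 + 1, by have := i.2; omega⟩ : ℕ) + 1))
                 (xv K ((σ ⟨2 * i.1 + 2, by have := i.2; omega⟩ : ℕ) + 1))).prod)) := by
  intro hf
  have hn0 : 0 < n := by omega
  have hn1 : 1 < n := by omega
  have hpar : n = n / 2 * 2 := (Nat.div_mul_cancel hne.two_dvd).symm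
  let v : ℕ → (ℕ →₀ K) := fun j =>
    Finsupp.single (if j = 0 then 0 else if j = 1 then n - 1 else j - 1) 1
  have hn0' : n ≠ 0 := by omega
  have hn1' : n ≠ 1 := by omega
  have hvn : v n = v 1 := by simp [v, hn0', hn1']
  let z : ℕ → Einf K := fun j =>
    if j = 0 then 1 else if j = n then ExteriorAlgebra.ι K (v 0) * ExteriorAlgebra.ι K (v 1) else 0
  have hz : ∀ j a, Commute (z j) a := by
    intro j a
    simp only [z]
    split_ifs
    · exact Commute.one_left a
    · exact commute_ι_mul_ι _ _ a
    · exact Commute.zero_left a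
  let β : ℕ → Einf K := fun j => if j = 1 then 1 else 0
  let d : ℕ → Einf K := fun j => ExteriorAlgebra.ι K (v j) + z j
  let g : Fin n → algA K (ℕ →₀ K) := fun i =>
    ⟨secondCol (β i) (d i), (evenPart K (ℕ →₀ K)).zero_mem, rfl⟩
  let p : ℕ → FreeAlgebra K (Fin n) := fun j =>
    if h : j - 1 < n then FreeAlgebra.ι K ⟨j - 1, h⟩
    else FreeAlgebra.ι K ⟨0, hn0⟩ * FreeAlgebra.ι K ⟨1, hn1⟩
  have h0 := congrArg (algA K (ℕ →₀ K)).val (hf.lift_eq_zero_of_relFree g p)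
  rw [← AlgHom.comp_apply, map_zero] at h0
  generalize hΦ : (algA K (ℕ →₀ K)).val.comp
    (FreeAlgebra.lift K fun j => FreeAlgebra.lift K g (p j)) = Φ at h0
  have hΦx : ∀ j : Fin (n + 1), Φ (xv K (j + 1)) = secondCol (β j) (d j) := by
    intro j
    rw [← hΦ]
    obtain hj | hj := Nat.lt_succ_iff_lt_or_eq.mp j.2
    · simp [xv, p, g, hj]
    · have hp : p (n + 1) = FreeAlgebra.ι K ⟨0, hn0⟩ * FreeAlgebra.ι K ⟨1, hn1⟩ :=
        dif_neg (by omega)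
      have hβ : β 0 * d 1 = β n := by simp [β, hn1']
      have hd : d 0 * d 1 = d n := by
        have hz0 : z 0 = 1 := if_pos rfl
        have hz1 : z 1 = 0 := by simp [z, hn1'.symm]
        have hzn : z n = ExteriorAlgebra.ι K (v 0) * ExteriorAlgebra.ι K (v 1) := by simp [z, hn0']
        simp only [d]
        rw [hz0, hz1, hzn, hvn, add_zero, add_mul, one_mul, add_comm]
      rw [hj, AlgHom.comp_apply, xv, FreeAlgebra.lift_ι_apply, hp, map_mul,
        FreeAlgebra.lift_ι_apply, FreeAlgebra.lift_ι_apply, map_mul, ← hβ, ← hd]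
      exact secondCol_mul (β 0) (d 0) (β 1) (d 1)
  have hΦ1 : Φ (xv K 1) = secondCol 0 (d 0) := hΦx 0
  have h1 := congrFun (congrFun h0 0) 1
  simp only [map_sum, map_zsmul, Matrix.sum_apply, Matrix.smul_apply, map_mul, map_commPow, map_list_prod,
    List.map_ofFn, Function.comp_def, map_br, hΦ1, hΦx, Matrix.zero_apply] at h1
  have hterm := secondCol_commPow_mul_prod_br_apply (k := m - n - 1) hpar hn1 (fun j => v j)
    (fun j => z j) (fun j => β j) (fun j => hz j) (if_pos rfl) (if_pos rfl)
    (fun j hj => if_neg fun h => hj (Fin.ext h))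
  simp only [Fin.val_zero] at hterm
  simp only [d, hterm] at h1
  simp only [smul_comm _ ((2 : K) ^ (n / 2)), ← Finset.smul_sum] at h1
  rw [sum_perm_sign_smul_ιMulti (fun j => v j)] at h1
  have hu : (fun i : Fin n => v (Equiv.swap (0 : Fin (n + 1)) ⟨1, by omega⟩ i.succ)) =
      fun i : Fin n => Finsupp.single (i : ℕ) (1 : K) := by
    funext i
    by_cases hi : (i : ℕ) = 0
    · have : i.succ = ⟨1, by omega⟩ := Fin.ext (by simp [hi])
      rw [this, Equiv.swap_apply_right]
      simp [v, hi]
    · rw [Equiv.swap_apply_of_ne_of_ne (Fin.succ_ne_zero i) (by simp [Fin.ext_iff, hi])]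
      simp [v, hi]
  rw [hu] at h1
  refine ιMulti_single_ne_zero (K := K) n ?_
  have h2 : (2 : K) ^ (n / 2) ≠ 0 := pow_ne_zero _ two_ne_zero
  have h3 := (smul_eq_zero.mp h1).resolve_left h2
  rw [← Units.smul_def, smul_eq_zero_iff_eq, ← Nat.cast_smul_eq_nsmul K] at h3
  exact (smul_eq_zero.mp h3).resolve_left (Nat.cast_ne_zero.mpr n.factorial_ne_zero)
end
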